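/- arXiv:2306.06296 — 6 statements merged into one kernel-verified Lean document; each statement's English description precedes it below -/
import Mathlib

section
/- Let C > 0 and let x₀ be a real number with |x₀| < C. Define P : ℝ → ℝ by P(z) = (e^{2Cz} − e^{−2x₀z})/(e^{2Cz} − e^{−2Cz}) for z ≠ 0 and P(0) = (C + x₀)/(2C). Then P is strictly monotonically increasing on ℝ. -/
noncomputable def ddmF (t : ℝ) : ℝ := if t = 0 then 1 else (Real.exp t - 1) / t

theorem ddmF_strictMono : StrictMono ddmF := by
  intro x y hxy
  unfold ddmF
  by_cases hx : x = 0
  · subst hx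
    rw [if_pos rfl, if_neg hxy.ne', lt_div_iff₀ hxy]
    linarith [Real.add_one_lt_exp hxy.ne']
  · by_cases hy : y = 0
    · subst hy
      rw [if_pos rfl, if_neg hx, div_lt_iff_of_neg hxy]
      linarith [Real.add_one_lt_exp hx]
    · rw [if_neg hx, if_neg hy]
      have := strictConvexOn_exp.secant_strict_mono (Set.mem_univ 0) (Set.mem_univ x)
        (Set.mem_univ y) hx hy hxy
      simpa using this

theorem ddmF_pos (t : ℝ) : 0 < ddmF t := by
  unfold ddmF
  split_ifs with h
  · exact one_pos
  · rcases lt_or_gt_of_ne h with h | h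
    · exact div_pos_of_neg_of_neg (by linarith [Real.exp_lt_exp.2 h, Real.exp_zero]) h
    · exact div_pos (by linarith [Real.add_one_lt_exp h.ne']) h

theorem ddmF_mul (a z : ℝ) (ha : a ≠ 0) (hz : z ≠ 0) :
    a * ddmF (a * z) = (Real.exp (a * z) - 1) / z := by
  unfold ddmF
  rw [if_neg (mul_ne_zero ha hz)]
  field_simp

/-- The continuously extended DDM link is strictly monotonically increasing on `ℝ`. -/
theorem ddm_link_strictMono (C x₀ : ℝ) (hC : 0 < C) (hx₀ : |x₀| < C)
    (P : ℝ → ℝ)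
    (hP : ∀ z : ℝ, P z = if z = 0 then (C + x₀) / (2 * C) else
        (Real.exp (2 * C * z) - Real.exp (-2 * x₀ * z)) /
          (Real.exp (2 * C * z) - Real.exp (-2 * C * z))) :
    StrictMono P := by
  obtain ⟨h1, h2⟩ := abs_lt.1 hx₀
  obtain ⟨a, ha⟩ : ∃ a, a = 2 * (C + x₀) := ⟨_, rfl⟩
  obtain ⟨b, hb⟩ : ∃ b, b = 2 * (C - x₀) := ⟨_, rfl⟩
  have ha0 : 0 < a := by linarith
  have hb0 : 0 < b := by linarith
  have key : ∀ z, P z = a * ddmF (a * z) / (a * ddmF (a * z) + b * ddmF (-b * z)) := by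
    intro z
    rw [hP]
    split_ifs with hz
    · subst hz
      simp only [mul_zero, ddmF, if_true, mul_one]
      have e : a + b = 2 * (2 * C) := by rw [ha, hb]; ring
      rw [e, ha, mul_div_mul_left _ _ two_ne_zero]
    · have e2 : b * ddmF (-b * z) = (1 - Real.exp (-b * z)) / z := by
        have := ddmF_mul (-b) z (by linarith) hz
        have h3 : b * ddmF (-b * z) = -(-b * ddmF (-b * z)) := by ring
        rw [h3, this]; ring
      rw [ddmF_mul a z ha0.ne' hz, e2, ← add_div, div_div_div_cancel_right₀ hz]
      have e3 : Real.exp (2 * C * z) = Real.exp (-2 * x₀ * z) * Real.exp (a * z) := by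
        rw [← Real.exp_add, ha]; ring_nf
      have e4 : Real.exp (-2 * C * z) = Real.exp (-2 * x₀ * z) * Real.exp (-b * z) := by
        rw [← Real.exp_add, hb]; ring_nf
      rw [e3, e4, ← mul_sub, ← mul_sub_one, mul_div_mul_left _ _ (Real.exp_pos _).ne']
      congr 1; ring
  intro x y hxy
  rw [key, key]
  have p1 := mul_pos ha0 (ddmF_pos (a * x))
  have p2 := mul_pos ha0 (ddmF_pos (a * y))
  have p3 := mul_pos hb0 (ddmF_pos (-b * x))
  have p4 := mul_pos hb0 (ddmF_pos (-b * y))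
  have q1 : a * ddmF (a * x) < a * ddmF (a * y) :=
    mul_lt_mul_of_pos_left (ddmF_strictMono (mul_lt_mul_of_pos_left hxy ha0)) ha0
  have q2 : b * ddmF (-b * y) < b * ddmF (-b * x) :=
    mul_lt_mul_of_pos_left (ddmF_strictMono (by nlinarith)) hb0
  rw [div_lt_div_iff₀ (by linarith) (by linarith)]
  have := mul_lt_mul'' q1 q2 p1.le p4.le
  linarith
end

section
/- Let m ∈ ℝ, v > 0 and s > 0, and set η = m − (√v/s)(2 + √(4 + s²)), α = 2 + (m − η)²/v, β = (m − η)(α − 1). Then the shifted inverse gamma density f(x; α, β, η) = (β^α/Γ(α)) · (x − η)^{−α−1} · exp(−β/(x − η)) for x > η (and 0 otherwise) has mean m, i.e. ∫_ℝ x·f(x; α, β, η) dx = m. -/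
open MeasureTheory Real

lemma invGamma_integral (a b : ℝ) (ha : 0 < a) (hb : 0 < b) :
    ∫ y in Set.Ioi (0:ℝ), y ^ (-a - 1) * Real.exp (-b / y) = (1 / b) ^ a * Real.Gamma a := by
  rw [← Real.integral_rpow_mul_exp_neg_mul_Ioi ha hb,
    ← integral_comp_rpow_Ioi (fun t : ℝ => t ^ (a - 1) * Real.exp (-(b * t)))
      (p := -1) (by norm_num)]
  refine setIntegral_congr_fun measurableSet_Ioi (fun y hy => ?_)
  have hy' : (0:ℝ) < y := hy
  simp only [smul_eq_mul, abs_neg, abs_one, one_mul]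
  rw [← Real.rpow_mul hy'.le, ← mul_assoc, ← Real.rpow_add hy', Real.rpow_neg_one]
  congr 1
  · congr 1; ring
  · congr 1; rw [neg_div]; rfl

lemma invGamma_integrable (a b : ℝ) (ha : 0 < a) (hb : 0 < b) :
    IntegrableOn (fun y : ℝ => y ^ (-a - 1) * Real.exp (-b / y)) (Set.Ioi (0:ℝ)) := by
  refine Integrable.of_integral_ne_zero ?_
  rw [invGamma_integral a b ha hb]
  have := Real.Gamma_pos_of_pos ha
  positivity

/-- The moment-matched shifted inverse gamma density has mean `m`. -/
theorem shifted_inverse_gamma_mean (m v s η α β : ℝ) (hv : 0 < v) (hs : 0 < s)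
    (hη : η = m - Real.sqrt v / s * (2 + Real.sqrt (4 + s ^ 2)))
    (hα : α = 2 + (m - η) ^ 2 / v) (hβ : β = (m - η) * (α - 1)) :
    ∫ x : ℝ, x * (if η < x then
        β ^ α / Real.Gamma α * (x - η) ^ (-α - 1) * Real.exp (-β / (x - η))
      else 0) = m := by
  have hmη : 0 < m - η := by
    have : m - η = Real.sqrt v / s * (2 + Real.sqrt (4 + s ^ 2)) := by rw [hη]; ring
    rw [this]; positivity
  have hα2 : 2 < α := by
    have : 0 < (m - η) ^ 2 / v := by positivity
    linarith
  have hα1 : 0 < α - 1 := by linarith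
  have hα0 : 0 < α := by linarith
  have hβ0 : 0 < β := by rw [hβ]; positivity
  have hG := Real.Gamma_pos_of_pos hα1
  have hGα : Real.Gamma α = (α - 1) * Real.Gamma (α - 1) := by
    have := Real.Gamma_add_one hα1.ne'
    rwa [sub_add_cancel] at this
  rw [← integral_add_right_eq_self _ η]
  have key : (fun x : ℝ => (x + η) * (if η < x + η then
        β ^ α / Real.Gamma α * (x + η - η) ^ (-α - 1) * Real.exp (-β / (x + η - η))
      else 0)) = (Set.Ioi (0:ℝ)).indicator (fun y =>
        β ^ α / Real.Gamma α * (y ^ (-(α - 1) - 1) * Real.exp (-β / y)) +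
        β ^ α / Real.Gamma α * η * (y ^ (-α - 1) * Real.exp (-β / y))) := by
    funext x
    by_cases hx : 0 < x
    · rw [Set.indicator_of_mem (Set.mem_Ioi.2 hx), if_pos (by linarith), add_sub_cancel_right]
      have : x ^ (-(α - 1) - 1) = x * x ^ (-α - 1) := by
        rw [show -(α - 1) - 1 = 1 + (-α - 1) by ring, Real.rpow_add hx, Real.rpow_one]
      rw [this]; ring
    · rw [Set.indicator_of_notMem (by simpa using hx), if_neg (by linarith), mul_zero]
  rw [key, integral_indicator measurableSet_Ioi,
    integral_add ((invGamma_integrable _ _ hα1 hβ0).const_mul _)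
      ((invGamma_integrable _ _ hα0 hβ0).const_mul _),
    integral_const_mul, integral_const_mul, invGamma_integral _ _ hα1 hβ0,
    invGamma_integral _ _ hα0 hβ0, hGα]
  have hP : 0 < β ^ α := Real.rpow_pos_of_pos hβ0 _
  have h1 : (1 / β) ^ α = (β ^ α)⁻¹ := by rw [one_div, Real.inv_rpow hβ0.le]
  have h2 : (1 / β) ^ (α - 1) = β * (β ^ α)⁻¹ := by
    rw [one_div, Real.inv_rpow hβ0.le, Real.rpow_sub_one hβ0.ne', inv_div]; rfl
  rw [h1, h2]
  have h3 : β / (α - 1) = m - η := by rw [hβ]; field_simp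
  calc _ = β / (α - 1) + η := by field_simp
    _ = m := by rw [h3]; ring
end

section
/- Let m ∈ ℝ, v > 0 and s > 0, and set η = m − (√v/s)(2 + √(4 + s²)), α = 2 + (m − η)²/v, β = (m − η)(α − 1). Then the shifted inverse gamma density f(x; α, β, η) = (β^α/Γ(α)) · (x − η)^{−α−1} · exp(−β/(x − η)) for x > η (and 0 otherwise) has variance v, i.e. ∫_ℝ (x − m)²·f(x; α, β, η) dx = v. -/
open MeasureTheory Real

lemma aux_point (a b x : ℝ) (hx : 0 < x) :
    (|(-1:ℝ)| * x ^ ((-1:ℝ) - 1)) • ((x ^ (-1:ℝ)) ^ (a - 1) * Real.exp (-(b * x ^ (-1:ℝ))))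
      = x ^ (-a - 1) * Real.exp (-b / x) := by
  rw [← Real.rpow_mul hx.le, smul_eq_mul, abs_neg, abs_one, one_mul, ← mul_assoc,
    ← Real.rpow_add hx, Real.rpow_neg_one]
  congr 2 <;> ring

lemma aux_int (a b : ℝ) (ha : 0 < a) (hb : 0 < b) :
    IntegrableOn (fun x : ℝ => x ^ (-a - 1) * Real.exp (-b / x)) (Set.Ioi 0) := by
  have h : IntegrableOn (fun t : ℝ => t ^ (a - 1) * Real.exp (-(b * t))) (Set.Ioi 0) := by
    have := integrableOn_rpow_mul_exp_neg_mul_rpow (p := 1) (s := a - 1) (b := b)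
      (by linarith) one_pos hb
    simpa using this
  rw [← integrableOn_Ioi_comp_rpow_iff _ (show (-1:ℝ) ≠ 0 by norm_num)] at h
  exact h.congr_fun (fun x hx => aux_point a b x hx) measurableSet_Ioi

lemma aux_val (a b : ℝ) (ha : 0 < a) (hb : 0 < b) :
    ∫ x in Set.Ioi (0:ℝ), x ^ (-a - 1) * Real.exp (-b / x) = (1 / b) ^ a * Real.Gamma a := by
  rw [← Real.integral_rpow_mul_exp_neg_mul_Ioi ha hb,
    ← integral_comp_rpow_Ioi (fun t : ℝ => t ^ (a - 1) * Real.exp (-(b * t))) (show (-1:ℝ) ≠ 0 by norm_num)]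
  exact (setIntegral_congr_fun measurableSet_Ioi (fun x hx => aux_point a b x hx)).symm

/-- The moment-matched shifted inverse gamma density has variance `v`. -/
theorem shifted_inverse_gamma_variance (m v s η α β : ℝ) (hv : 0 < v) (hs : 0 < s)
    (hη : η = m - Real.sqrt v / s * (2 + Real.sqrt (4 + s ^ 2)))
    (hα : α = 2 + (m - η) ^ 2 / v) (hβ : β = (m - η) * (α - 1)) :
    ∫ x : ℝ, (x - m) ^ 2 * (if η < x then
        β ^ α / Real.Gamma α * (x - η) ^ (-α - 1) * Real.exp (-β / (x - η))
      else 0) = v := by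
  obtain ⟨d, hd⟩ : ∃ d, d = m - η := ⟨_, rfl⟩
  have hd0 : 0 < d := by
    have : 0 < Real.sqrt v / s * (2 + Real.sqrt (4 + s ^ 2)) := by positivity
    linarith
  rw [← hd] at hα hβ
  clear hη
  obtain ⟨c, hc⟩ : ∃ c, c = d ^ 2 / v := ⟨_, rfl⟩
  have hc0 : 0 < c := by rw [hc]; positivity
  rw [← hc] at hα
  have hβ0 : 0 < β := by rw [hβ, hα]; exact mul_pos hd0 (by linarith)
  have hG : Real.Gamma α = (c + 1) * (c * Real.Gamma c) := by
    rw [← Real.Gamma_add_one hc0.ne', ← Real.Gamma_add_one (by linarith), hα]; congr 1; ring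
  have hG1 : Real.Gamma (c + 1) = c * Real.Gamma c := Real.Gamma_add_one hc0.ne'
  have hGc := Real.Gamma_pos_of_pos hc0
  set K := β ^ α / Real.Gamma α with hK
  have step : ∀ y ∈ Set.Ioi (0:ℝ), (y - d) ^ 2 * (K * y ^ (-α - 1) * Real.exp (-β / y))
      = K * ((y ^ (-c - 1) * Real.exp (-β / y)) - 2 * d * (y ^ (-(c+1) - 1) * Real.exp (-β / y))
        + d ^ 2 * (y ^ (-α - 1) * Real.exp (-β / y))) := by
    intro y hy
    have hy : 0 < y := hy
    have e1 : y ^ (-c - 1) = y ^ (-α - 1) * y ^ 2 := by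
      rw [← Real.rpow_natCast y 2, ← Real.rpow_add hy, hα]; congr 1; push_cast; ring
    have e2 : y ^ (-(c+1) - 1) = y ^ (-α - 1) * y := by
      rw [← Real.rpow_add_one hy.ne', hα]; congr 1; ring
    rw [e1, e2]; ring
  have i1 := aux_int c β hc0 hβ0
  have i2 := aux_int (c+1) β (by linarith) hβ0
  have i3 := aux_int α β (by linarith) hβ0
  have i12 : IntegrableOn (fun y : ℝ => (y ^ (-c - 1) * Real.exp (-β / y))
      - 2 * d * (y ^ (-(c+1) - 1) * Real.exp (-β / y))) (Set.Ioi 0) :=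
    i1.sub (i2.const_mul _)
  have tr : ∫ x : ℝ, (x - m) ^ 2 * (if η < x then
        K * (x - η) ^ (-α - 1) * Real.exp (-β / (x - η)) else 0)
      = ∫ y in Set.Ioi (0:ℝ), (y - d) ^ 2 * (K * y ^ (-α - 1) * Real.exp (-β / y)) := by
    rw [← integral_indicator measurableSet_Ioi, ← integral_sub_right_eq_self (Set.indicator _ _) η]
    congr 1
    ext x
    by_cases h : η < x
    · have h2 : x - η ∈ Set.Ioi (0:ℝ) := by simpa using h
      rw [Set.indicator_of_mem h2, if_pos h, hd]; ring
    · have h2 : x - η ∉ Set.Ioi (0:ℝ) := by simpa using h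
      rw [Set.indicator_of_notMem h2, if_neg h, mul_zero]
  rw [tr, setIntegral_congr_fun measurableSet_Ioi step, integral_const_mul,
    integral_add i12 (i3.const_mul _),
    integral_sub i1 (i2.const_mul _), integral_const_mul, integral_const_mul,
    aux_val c β hc0 hβ0, aux_val (c+1) β (by linarith) hβ0, aux_val α β (by linarith) hβ0,
    hK, hG1, hG]
  have p0 : 0 < β ^ c := Real.rpow_pos_of_pos hβ0 _
  have b2 : β ^ α = β ^ c * β ^ 2 := by
    rw [← Real.rpow_natCast β 2, ← Real.rpow_add hβ0, hα]; congr 1; push_cast; ring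
  have b1 : β ^ (c + 1) = β ^ c * β := Real.rpow_add_one hβ0.ne' _
  simp only [one_div, Real.inv_rpow hβ0.le, b1, b2]
  have hv' : v = d ^ 2 / c := by rw [hc]; field_simp
  have hβ' : β = d * (c + 1) := by rw [hβ, hα]; ring
  have hc1 : c + 1 ≠ 0 := by linarith
  rw [hv']
  generalize β ^ c = B at *
  generalize Real.Gamma c = G at *
  subst hβ'
  field_simp
  ring
end

section
/- Let m ∈ ℝ, v > 0 and s > 0, and set η = m − (√v/s)(2 + √(4 + s²)), α = 2 + (m − η)²/v, β = (m − η)(α − 1). Then the shifted inverse gamma density f(x; α, β, η) = (β^α/Γ(α)) · (x − η)^{−α−1} · exp(−β/(x − η)) for x > η (and 0 otherwise) has skewness s, i.e. ∫_ℝ ((x − m)/√v)³·f(x; α, β, η) dx = s. -/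
open MeasureTheory Real

lemma aux_moment (a b : ℝ) (ha : 0 < a) (hb : 0 < b) :
    ∫ y in Set.Ioi (0:ℝ), y ^ (-a - 1) * Real.exp (-b / y) = b ^ (-a) * Real.Gamma a := by
  have h1 := integral_comp_rpow_Ioi (fun t : ℝ => t ^ (a - 1) * Real.exp (-(b * t)))
    (p := -1) (by norm_num)
  rw [Real.integral_rpow_mul_exp_neg_mul_Ioi ha hb] at h1
  rw [Real.rpow_neg hb.le, ← Real.inv_rpow hb.le, ← one_div, ← h1]
  refine setIntegral_congr_fun measurableSet_Ioi (fun y hy => ?_)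
  have hy : 0 < y := hy
  simp only [smul_eq_mul, abs_neg, abs_one, one_mul]
  rw [← Real.rpow_mul hy.le, ← mul_assoc, ← Real.rpow_add hy, Real.rpow_neg_one]
  congr 2 <;> ring

lemma aux_integrable (a b : ℝ) (ha : 0 < a) (hb : 0 < b) :
    IntegrableOn (fun y : ℝ => y ^ (-a - 1) * Real.exp (-b / y)) (Set.Ioi 0) := by
  apply Integrable.of_integral_ne_zero
  rw [aux_moment a b ha hb]
  have := Real.Gamma_pos_of_pos ha
  positivity

lemma aux_third (α β d : ℝ) (hα : 3 < α) (hβ : 0 < β) :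
    ∫ y in Set.Ioi (0:ℝ), (y - d) ^ 3 * (y ^ (-α - 1) * Real.exp (-β / y)) =
      β ^ (-(α - 3)) * Real.Gamma (α - 3) - 3 * d * (β ^ (-(α - 2)) * Real.Gamma (α - 2))
      + 3 * d ^ 2 * (β ^ (-(α - 1)) * Real.Gamma (α - 1)) - d ^ 3 * (β ^ (-α) * Real.Gamma α) := by
  have i3 := aux_integrable (α - 3) β (by linarith) hβ
  have i2 := (aux_integrable (α - 2) β (by linarith) hβ).const_mul (3 * d)
  have i1 := (aux_integrable (α - 1) β (by linarith) hβ).const_mul (3 * d ^ 2)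
  have i0 := (aux_integrable α β (by linarith) hβ).const_mul (d ^ 3)
  rw [← aux_moment (α - 3) β (by linarith) hβ, ← aux_moment (α - 2) β (by linarith) hβ,
    ← aux_moment (α - 1) β (by linarith) hβ, ← aux_moment α β (by linarith) hβ,
    ← integral_const_mul, ← integral_const_mul, ← integral_const_mul,
    ← integral_sub' i3 i2, ← integral_add' (i3.sub i2) i1, ← integral_sub' ((i3.sub i2).add i1) i0]
  refine setIntegral_congr_fun measurableSet_Ioi (fun y hy => ?_)
  have hy : 0 < y := hy
  have e3 : y ^ (-(α - 3) - 1) = y ^ (-α - 1) * y ^ 3 := by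
    rw [← Real.rpow_natCast y 3, ← Real.rpow_add hy]; congr 1; push_cast; ring
  have e2 : y ^ (-(α - 2) - 1) = y ^ (-α - 1) * y ^ 2 := by
    rw [← Real.rpow_natCast y 2, ← Real.rpow_add hy]; congr 1; push_cast; ring
  have e1 : y ^ (-(α - 1) - 1) = y ^ (-α - 1) * y := by
    nth_rewrite 3 [← Real.rpow_one y]
    rw [← Real.rpow_add hy]; congr 1; ring
  simp only [Pi.sub_apply, Pi.add_apply]
  rw [e3, e2, e1]
  ring

/-- The moment-matched shifted inverse gamma density has skewness `s`. -/
theorem shifted_inverse_gamma_skewness (m v s η α β : ℝ) (hv : 0 < v) (hs : 0 < s)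
    (hη : η = m - Real.sqrt v / s * (2 + Real.sqrt (4 + s ^ 2)))
    (hα : α = 2 + (m - η) ^ 2 / v) (hβ : β = (m - η) * (α - 1)) :
    ∫ x : ℝ, ((x - m) / Real.sqrt v) ^ 3 * (if η < x then
        β ^ α / Real.Gamma α * (x - η) ^ (-α - 1) * Real.exp (-β / (x - η))
      else 0) = s := by
  obtain ⟨w, hw⟩ : ∃ w, w = Real.sqrt v := ⟨_, rfl⟩
  have hw0 : 0 < w := hw ▸ Real.sqrt_pos.2 hv
  have hwv : v = w ^ 2 := by rw [hw, Real.sq_sqrt hv.le]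
  obtain ⟨q, hq⟩ : ∃ q, q = Real.sqrt (4 + s ^ 2) := ⟨_, rfl⟩
  have hq0 : 0 ≤ q := hq ▸ Real.sqrt_nonneg _
  have hqs : q ^ 2 = 4 + s ^ 2 := by rw [hq, Real.sq_sqrt (by positivity)]
  obtain ⟨t, ht⟩ : ∃ t, t = (2 + q) / s := ⟨_, rfl⟩
  have hd : m - η = w * t := by rw [hη, ← hw, ← hq, ht]; ring
  have hts : t * s = 2 + q := by rw [ht]; field_simp
  have ht0 : 0 < t := by rw [ht]; positivity
  have hteq : s * (t ^ 2 - 1) = 4 * t := by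
    have : s * (s * (t ^ 2 - 1)) = s * (4 * t) := by
      have : q = t * s - 2 := by linarith
      rw [this] at hqs; nlinarith
    exact mul_left_cancel₀ hs.ne' this
  have ht1 : 0 < t ^ 2 - 1 := by
    by_contra h
    nlinarith [mul_nonneg hs.le (by linarith : (0:ℝ) ≤ -(t^2-1))]
  have hα' : α = 2 + t ^ 2 := by rw [hα, hd, hwv]; field_simp
  have hα3 : 3 < α := by linarith
  rw [hd] at hβ
  have hβ0 : 0 < β := by rw [hβ]; have : 0 < α - 1 := by linarith
                         positivity
  rw [← hw]
  have hm : m = η + w * t := by linarith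
  have step : ∫ x : ℝ, ((x - m) / w) ^ 3 * (if η < x then
        β ^ α / Real.Gamma α * (x - η) ^ (-α - 1) * Real.exp (-β / (x - η)) else 0) =
      (β ^ α / Real.Gamma α / w ^ 3) *
        ∫ y in Set.Ioi (0:ℝ), (y - w * t) ^ 3 * (y ^ (-α - 1) * Real.exp (-β / y)) := by
    rw [← integral_const_mul, ← integral_indicator measurableSet_Ioi,
      ← integral_sub_right_eq_self (Set.indicator _ _) η]
    congr 1
    funext x
    by_cases hx : η < x
    · rw [if_pos hx, Set.indicator_of_mem (by simpa using hx), hm]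
      field_simp
      ring
    · rw [if_neg hx, Set.indicator_of_notMem (by simpa using hx), mul_zero]
  rw [step, aux_third α β (w * t) hα3 hβ0]
  have g1 : Real.Gamma (α - 2) = (α - 3) * Real.Gamma (α - 3) := by
    rw [← Real.Gamma_add_one (by linarith)]; congr 1; ring
  have g2 : Real.Gamma (α - 1) = (α - 2) * Real.Gamma (α - 2) := by
    rw [← Real.Gamma_add_one (by linarith)]; congr 1; ring
  have g3 : Real.Gamma α = (α - 1) * Real.Gamma (α - 1) := by
    rw [← Real.Gamma_add_one (by linarith)]; congr 1; ring
  have hG : 0 < Real.Gamma (α - 3) := Real.Gamma_pos_of_pos (by linarith)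
  have b0 : β ^ (-α) = (β ^ α)⁻¹ := Real.rpow_neg hβ0.le _
  have b1 : β ^ (-(α - 1)) = (β ^ α)⁻¹ * β := by
    rw [← b0]
    nth_rewrite 3 [← Real.rpow_one β]
    rw [← Real.rpow_add hβ0]; congr 1; ring
  have b2 : β ^ (-(α - 2)) = (β ^ α)⁻¹ * β ^ 2 := by
    rw [← b0, ← Real.rpow_natCast β 2, ← Real.rpow_add hβ0]; congr 1; push_cast; ring
  have b3 : β ^ (-(α - 3)) = (β ^ α)⁻¹ * β ^ 3 := by
    rw [← b0, ← Real.rpow_natCast β 3, ← Real.rpow_add hβ0]; congr 1; push_cast; ring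
  rw [b0, b1, b2, b3, g3, g2, g1]
  have hB : 0 < β ^ α := Real.rpow_pos_of_pos hβ0 _
  generalize Real.Gamma (α - 3) = G at hG
  generalize β ^ α = B at hB
  have hs' : s = 4 * t / (t ^ 2 - 1) := by rw [eq_div_iff ht1.ne', hteq]
  rw [hs', hβ, hα']
  have n1 : 2 + t ^ 2 - 1 = t ^ 2 + 1 := by ring
  have n2 : 2 + t ^ 2 - 2 = t ^ 2 := by ring
  have n3 : 2 + t ^ 2 - 3 = t ^ 2 - 1 := by ring
  rw [n1, n2, n3]
  have := ht1.ne'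
  have : t ^ 2 + 1 ≠ 0 := by positivity
  field_simp
  ring
end

section
/- Let m ∈ ℝ, v > 0 and s > 0, let B = (1/2)(s² + 2 − √(s⁴ + 4s²)), and set η = m − (√v/s)(1 + B^{1/3} + B^{−1/3}), σ² = ln(1 + v/(m − η)²), μ = ln(m − η) − σ²/2. Then the shifted lognormal density f(x; μ, σ, η) = 1/(σ(x − η)√(2π)) · exp(−(ln(x − η) − μ)²/(2σ²)) for x > η (and 0 otherwise) has variance v, i.e. ∫_ℝ (x − m)²·f(x; μ, σ, η) dx = v. -/
open MeasureTheory Real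

/-- The moment-matched shifted lognormal density has variance `v`. -/
theorem shifted_lognormal_variance (m v s B η σ μ : ℝ) (hv : 0 < v) (hs : 0 < s)
    (hB : B = (1 / 2) * (s ^ 2 + 2 - Real.sqrt (s ^ 4 + 4 * s ^ 2)))
    (hη : η = m - Real.sqrt v / s * (1 + B ^ ((1 : ℝ) / 3) + B ^ (-(1 : ℝ) / 3)))
    (hσ : σ ^ 2 = Real.log (1 + v / (m - η) ^ 2)) (hσ0 : 0 < σ)
    (hμ : μ = Real.log (m - η) - σ ^ 2 / 2) :
    ∫ x : ℝ, (x - m) ^ 2 * (if η < x then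
        1 / (σ * (x - η) * Real.sqrt (2 * Real.pi)) *
          Real.exp (-(Real.log (x - η) - μ) ^ 2 / (2 * σ ^ 2))
      else 0) = v := by
  have hB0 : 0 ≤ B := by
    have : Real.sqrt (s ^ 4 + 4 * s ^ 2) ≤ s ^ 2 + 2 := by
      apply Real.sqrt_le_iff.mpr
      constructor
      · positivity
      · nlinarith
    rw [hB]; linarith
  have hd : 0 < m - η := by
    have h1 := Real.rpow_nonneg hB0 ((1 : ℝ) / 3)
    have h2 := Real.rpow_nonneg hB0 (-(1 : ℝ) / 3)
    have h3 : 0 < Real.sqrt v / s := div_pos (Real.sqrt_pos.mpr hv) hs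
    have : m - η = Real.sqrt v / s * (1 + B ^ ((1 : ℝ) / 3) + B ^ (-(1 : ℝ) / 3)) := by
      linarith
    rw [this]; positivity
  clear hη hB hB0
  obtain ⟨d, hdd⟩ : ∃ d, d = m - η := ⟨_, rfl⟩
  obtain rfl : m = η + d := by linarith
  rw [← hdd] at hd hσ hμ
  clear hdd
  -- exponential facts
  have hE1 : Real.exp (μ + σ ^ 2 / 2) = d := by
    rw [hμ, sub_add_cancel, Real.exp_log hd]
  have hES : Real.exp (σ ^ 2) = 1 + v / d ^ 2 := by
    rw [hσ, Real.exp_log (by positivity)]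
  have hE2 : Real.exp (μ * 2 + σ ^ 2 * 2 ^ 2 / 2) = d ^ 2 + v := by
    have : μ * 2 + σ ^ 2 * 2 ^ 2 / 2 = (μ + σ ^ 2 / 2) + (μ + σ ^ 2 / 2) + σ ^ 2 := by ring
    rw [this, Real.exp_add, Real.exp_add, hE1, hES]
    field_simp
  -- change of variables
  let w : NNReal := ⟨σ ^ 2, by positivity⟩
  have hwr : (w : ℝ) = σ ^ 2 := rfl
  have hw : w ≠ 0 := by
    intro h
    have : (w : ℝ) = 0 := by rw [h]; rfl
    rw [hwr] at this
    exact (pow_pos hσ0 2).ne' this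
  have himg : (fun t : ℝ => η + Real.exp t) '' Set.univ = Set.Ioi η := by
    ext x
    simp only [Set.image_univ, Set.mem_range, Set.mem_Ioi]
    constructor
    · rintro ⟨t, rfl⟩
      have := Real.exp_pos t
      linarith
    · intro hx
      exact ⟨Real.log (x - η), by rw [Real.exp_log (by linarith)]; ring⟩
  have hmain : ∫ x : ℝ, (x - (η + d)) ^ 2 * (if η < x then
        1 / (σ * (x - η) * Real.sqrt (2 * Real.pi)) *
          Real.exp (-(Real.log (x - η) - μ) ^ 2 / (2 * σ ^ 2))
      else 0) = ∫ t, (Real.exp t - d) ^ 2 ∂(ProbabilityTheory.gaussianReal μ w) := by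
    rw [ProbabilityTheory.integral_gaussianReal_eq_integral_smul hw]
    have : ∀ x : ℝ, (x - (η + d)) ^ 2 * (if η < x then
        1 / (σ * (x - η) * Real.sqrt (2 * Real.pi)) *
          Real.exp (-(Real.log (x - η) - μ) ^ 2 / (2 * σ ^ 2))
      else 0) = (Set.Ioi η).indicator (fun x => (x - (η + d)) ^ 2 * (
        1 / (σ * (x - η) * Real.sqrt (2 * Real.pi)) *
          Real.exp (-(Real.log (x - η) - μ) ^ 2 / (2 * σ ^ 2)))) x := by
      intro x
      by_cases hx : η < x <;> simp [Set.indicator, hx]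
    simp_rw [this]
    rw [integral_indicator measurableSet_Ioi, ← himg,
      integral_image_eq_integral_abs_deriv_smul (f' := Real.exp) MeasurableSet.univ
        (fun t _ => ((Real.hasDerivAt_exp t).const_add η).hasDerivWithinAt)
        (fun a _ b _ h => by simpa using h), setIntegral_univ]
    congr 1
    ext t
    have h2 : Real.sqrt (2 * Real.pi * σ ^ 2) = Real.sqrt (2 * Real.pi) * σ := by
      rw [Real.sqrt_mul (by positivity), Real.sqrt_sq hσ0.le]
    have h3 : 0 < Real.sqrt (2 * Real.pi) := by positivity
    have h4 := Real.exp_pos t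
    simp only [ProbabilityTheory.gaussianPDFReal, smul_eq_mul, h2, hwr, add_sub_cancel_left,
      Real.log_exp, abs_of_pos h4, add_sub_add_left_eq_sub]
    field_simp
  rw [hmain]
  have i1 := ProbabilityTheory.integrable_exp_mul_gaussianReal (μ := μ) (v := w) 1
  have i2 := ProbabilityTheory.integrable_exp_mul_gaussianReal (μ := μ) (v := w) 2
  have e1 := congrFun (ProbabilityTheory.mgf_fun_id_gaussianReal (μ := μ) (v := w)) 1
  have e2 := congrFun (ProbabilityTheory.mgf_fun_id_gaussianReal (μ := μ) (v := w)) 2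
  simp only [ProbabilityTheory.mgf, hwr] at e1 e2
  rw [hE2] at e2
  have e1' : ∫ x, Real.exp (1 * x) ∂(ProbabilityTheory.gaussianReal μ w) = d := by
    rw [e1, ← hE1]; congr 1; ring
  have : ∀ t : ℝ, (Real.exp t - d) ^ 2
      = (Real.exp (2 * t) - (2 * d) * Real.exp (1 * t)) + d ^ 2 := by
    intro t
    rw [two_mul t, Real.exp_add, one_mul]; ring
  simp_rw [this]
  have i3 : Integrable (fun t => Real.exp (2 * t) - (2 * d) * Real.exp (1 * t))
      (ProbabilityTheory.gaussianReal μ w) := i2.sub (i1.const_mul _)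
  rw [integral_add i3 (integrable_const _),
    integral_sub i2 (i1.const_mul _), integral_const_mul, e2, e1']
  simp
  ring
end

section
/- Let m ∈ ℝ, v > 0 and s > 0, let B = (1/2)(s² + 2 − √(s⁴ + 4s²)), and set η = m − (√v/s)(1 + B^{1/3} + B^{−1/3}), σ² = ln(1 + v/(m − η)²), μ = ln(m − η) − σ²/2. Then the shifted lognormal density f(x; μ, σ, η) = 1/(σ(x − η)√(2π)) · exp(−(ln(x − η) − μ)²/(2σ²)) for x > η (and 0 otherwise) has skewness s, i.e. ∫_ℝ ((x − m)/√v)³·f(x; μ, σ, η) dx = s. -/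
open MeasureTheory Real

lemma aux_B (s B : ℝ) (hs : 0 < s)
    (hB : B = (1 / 2) * (s ^ 2 + 2 - Real.sqrt (s ^ 4 + 4 * s ^ 2))) :
    0 < B ∧ B + B⁻¹ = s ^ 2 + 2 := by
  have h0 : 0 ≤ s ^ 4 + 4 * s ^ 2 := by positivity
  have h1 := Real.sq_sqrt h0
  have h2 := Real.sqrt_nonneg (s ^ 4 + 4 * s ^ 2)
  set r := Real.sqrt (s ^ 4 + 4 * s ^ 2)
  have hlt : r < s ^ 2 + 2 := by
    apply lt_of_pow_lt_pow_left₀ 2 (by positivity)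
    nlinarith
  have hpos : 0 < B := by rw [hB]; linarith
  have hinv : B⁻¹ = (1 / 2) * (s ^ 2 + 2 + r) := by
    symm
    apply eq_inv_of_mul_eq_one_left
    rw [hB]
    nlinarith
  refine ⟨hpos, ?_⟩
  rw [hinv, hB]; ring

lemma aux_alg (v s B d : ℝ) (hv : 0 < v) (hs : 0 < s)
    (hB : B = (1 / 2) * (s ^ 2 + 2 - Real.sqrt (s ^ 4 + 4 * s ^ 2)))
    (hd : d = Real.sqrt v / s * (1 + B ^ ((1 : ℝ) / 3) + B ^ (-(1 : ℝ) / 3))) :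
    0 < d ∧ (Real.sqrt v / d) ^ 3 + 3 * (Real.sqrt v / d) = s := by
  obtain ⟨hp, h⟩ := aux_B s B hs hB
  have e1 : B ^ (-(1 : ℝ) / 3) = (B ^ ((1 : ℝ) / 3))⁻¹ := by
    rw [← Real.rpow_neg hp.le]; norm_num
  have e2 : (B ^ ((1 : ℝ) / 3)) ^ 3 = B := by
    rw [← Real.rpow_natCast, ← Real.rpow_mul hp.le]; norm_num
  have hc : 0 < B ^ ((1 : ℝ) / 3) := Real.rpow_pos_of_pos hp _
  rw [e1] at hd
  set c := B ^ ((1 : ℝ) / 3)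
  have hsv := Real.sqrt_pos.2 hv
  have hci : c * c⁻¹ = 1 := mul_inv_cancel₀ hc.ne'
  have hcp : 0 < c⁻¹ := inv_pos.2 hc
  rw [← e2, ← inv_pow] at h
  set k := c⁻¹
  have ht : (c + k) ^ 3 = s ^ 2 + 2 + 3 * (c + k) := by
    linear_combination h + 3 * (c + k) * hci
  have hT : 0 < 1 + c + k := by positivity
  refine ⟨by rw [hd]; positivity, ?_⟩
  have hu : Real.sqrt v / d = s / (1 + c + k) := by
    rw [hd]; field_simp
  rw [hu]
  field_simp
  linear_combination -ht

open ProbabilityTheory in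
lemma aux_gauss (μ a b : ℝ) (V : NNReal) :
    ∫ y, ((Real.exp y - a) / b) ^ 3 ∂(gaussianReal μ V) =
      (Real.exp (μ * 3 + V * 3 ^ 2 / 2) - 3 * a * Real.exp (μ * 2 + V * 2 ^ 2 / 2)
        + 3 * a ^ 2 * Real.exp (μ * 1 + V * 1 ^ 2 / 2) - a ^ 3) / b ^ 3 := by
  have hi (t : ℝ) := integrable_exp_mul_gaussianReal (μ := μ) (v := V) t
  have hm (t : ℝ) : ∫ y, Real.exp (t * y) ∂(gaussianReal μ V) = Real.exp (μ * t + V * t ^ 2 / 2) := by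
    have := congrFun (mgf_id_gaussianReal (μ := μ) (v := V)) t
    simpa [mgf] using this
  have : ∀ y : ℝ, ((Real.exp y - a) / b) ^ 3 = (Real.exp (3 * y) - 3 * a * Real.exp (2 * y)
      + 3 * a ^ 2 * Real.exp (1 * y) - a ^ 3) / b ^ 3 := by
    intro y
    have h3 : Real.exp (3 * y) = Real.exp y ^ 3 := by rw [← Real.exp_nat_mul]; norm_num
    have h2 : Real.exp (2 * y) = Real.exp y ^ 2 := by rw [← Real.exp_nat_mul]; norm_num
    rw [h3, h2, one_mul, div_pow]; ring
  simp_rw [this]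
  rw [integral_div, integral_sub, integral_add, integral_sub, integral_const_mul,
    integral_const_mul, hm, hm, hm]
  · simp
  · exact hi 3
  · exact (hi 2).const_mul _
  · exact (hi 3).sub ((hi 2).const_mul _)
  · exact (hi 1).const_mul _
  · exact ((hi 3).sub ((hi 2).const_mul _)).add ((hi 1).const_mul _)
  · exact integrable_const _

lemma aux_cov (η : ℝ) (g : ℝ → ℝ) :
    ∫ x in Set.Ioi η, g x = ∫ y, Real.exp y * g (η + Real.exp y) := by
  have him : (fun y => η + Real.exp y) '' Set.univ = Set.Ioi η := by
    ext x
    constructor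
    · rintro ⟨y, -, rfl⟩
      simp [Real.exp_pos]
    · intro hx
      exact ⟨Real.log (x - η), trivial, by
        simp only; rw [Real.exp_log (sub_pos.2 hx)]; ring⟩
  have := integral_image_eq_integral_abs_deriv_smul (s := Set.univ)
    (f := fun y => η + Real.exp y) (f' := Real.exp) MeasurableSet.univ
    (fun x _ => ((Real.hasDerivAt_exp x).const_add η).hasDerivWithinAt)
    (fun x _ y _ h => by simpa using h) g
  rw [him] at this
  simpa [abs_of_pos (Real.exp_pos _)] using this

/-- The moment-matched shifted lognormal density has skewness `s`. -/
theorem shifted_lognormal_skewness (m v s B η σ μ : ℝ) (hv : 0 < v) (hs : 0 < s)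
    (hB : B = (1 / 2) * (s ^ 2 + 2 - Real.sqrt (s ^ 4 + 4 * s ^ 2)))
    (hη : η = m - Real.sqrt v / s * (1 + B ^ ((1 : ℝ) / 3) + B ^ (-(1 : ℝ) / 3)))
    (hσ : σ ^ 2 = Real.log (1 + v / (m - η) ^ 2)) (hσ0 : 0 < σ)
    (hμ : μ = Real.log (m - η) - σ ^ 2 / 2) :
    ∫ x : ℝ, ((x - m) / Real.sqrt v) ^ 3 * (if η < x then
        1 / (σ * (x - η) * Real.sqrt (2 * Real.pi)) *
          Real.exp (-(Real.log (x - η) - μ) ^ 2 / (2 * σ ^ 2))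
      else 0) = s := by
  obtain ⟨hd, hkey⟩ := aux_alg v s B (m - η) hv hs hB (by linarith)
  set V : NNReal := ⟨σ ^ 2, sq_nonneg σ⟩ with hV
  have hVc : (V : ℝ) = σ ^ 2 := rfl
  have hV0 : V ≠ 0 := by
    intro h
    have : (V : ℝ) = 0 := by rw [h]; rfl
    rw [hVc] at this
    exact (pow_pos hσ0 2).ne' this
  have hG := aux_gauss μ (m - η) (Real.sqrt v) V
  rw [ProbabilityTheory.integral_gaussianReal_eq_integral_smul hV0] at hG
  have e1 : ∀ x : ℝ, ((x - m) / Real.sqrt v) ^ 3 * (if η < x then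
        1 / (σ * (x - η) * Real.sqrt (2 * Real.pi)) *
          Real.exp (-(Real.log (x - η) - μ) ^ 2 / (2 * σ ^ 2))
      else 0) = (Set.Ioi η).indicator (fun x => ((x - m) / Real.sqrt v) ^ 3 * (
        1 / (σ * (x - η) * Real.sqrt (2 * Real.pi)) *
          Real.exp (-(Real.log (x - η) - μ) ^ 2 / (2 * σ ^ 2)))) x := by
    intro x
    by_cases h : η < x <;> simp [h]
  simp_rw [e1]
  rw [integral_indicator measurableSet_Ioi, aux_cov]
  have e2 : ∀ y : ℝ, Real.exp y * (((η + Real.exp y - m) / Real.sqrt v) ^ 3 * (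
        1 / (σ * (η + Real.exp y - η) * Real.sqrt (2 * Real.pi)) *
          Real.exp (-(Real.log (η + Real.exp y - η) - μ) ^ 2 / (2 * σ ^ 2)))) =
      ProbabilityTheory.gaussianPDFReal μ V y •
        ((Real.exp y - (m - η)) / Real.sqrt v) ^ 3 := by
    intro y
    have hsq : Real.sqrt (2 * Real.pi * σ ^ 2) = Real.sqrt (2 * Real.pi) * σ := by
      rw [Real.sqrt_mul (by positivity), Real.sqrt_sq hσ0.le]
    have hp : 0 < Real.sqrt (2 * Real.pi) := by positivity
    rw [ProbabilityTheory.gaussianPDFReal, hVc, hsq, add_sub_cancel_left, Real.log_exp,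
      smul_eq_mul, show η + Real.exp y - m = Real.exp y - (m - η) by ring]
    have := Real.exp_pos y
    generalize Real.exp (-(y - μ) ^ 2 / (2 * σ ^ 2)) = E
    generalize ((Real.exp y - (m - η)) / Real.sqrt v) ^ 3 = Q
    field_simp
  simp_rw [e2]
  rw [hG, hVc]
  have hsv := Real.sqrt_pos.2 hv
  have hv2 := Real.sq_sqrt hv.le
  have hw : Real.exp (σ ^ 2) = 1 + v / (m - η) ^ 2 := by
    rw [hσ, Real.exp_log (by positivity)]
  have hl : Real.exp (Real.log (m - η)) = m - η := Real.exp_log hd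
  have x3 : Real.exp (μ * 3 + σ ^ 2 * 3 ^ 2 / 2) = (m - η) ^ 3 * (Real.exp (σ ^ 2)) ^ 3 := by
    rw [← hl, ← Real.exp_nat_mul, ← Real.exp_nat_mul, ← Real.exp_add, hμ]
    congr 1; push_cast; ring
  have x2 : Real.exp (μ * 2 + σ ^ 2 * 2 ^ 2 / 2) = (m - η) ^ 2 * Real.exp (σ ^ 2) := by
    rw [← hl, ← Real.exp_nat_mul, ← Real.exp_add, hμ]
    congr 1; push_cast; ring
  have x1 : Real.exp (μ * 1 + σ ^ 2 * 1 ^ 2 / 2) = m - η := by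
    rw [← hl, hl, hμ, ← hl]
    rw [hl]; nth_rewrite 2 [← hl]
    congr 1; ring
  rw [x3, x2, x1, hw, ← hkey]
  generalize m - η = d at *
  rw [← hv2]
  rw [Real.sqrt_sq hsv.le]
  generalize Real.sqrt v = q at *
  field_simp
  ring
end
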